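/- For all x ∈ [0, π_{3,6}/4), writing s = sin_{3,6}(x), one has sin_{3,6}(2x) = 2^{5/3} s (1+s^6) / ((1−s^3)(1+6s^3+s^6)^{3/2} + (1+s^3)(1−6s^3+s^6)^{3/2})^{2/3}. -/

import Mathlib

open MeasureTheory Set
open scoped ENNReal

/-- `genF p q y = ∫_0^y (1 - t^q)^(-1/p) dt`, whose inverse is the generalized sine. -/
noncomputable def genF (p q y : ℝ) : ℝ := ∫ t in (0:ℝ)..y, (1 - t ^ q) ^ (-(1 / p))

/-- `genG p q y = ∫_0^y (1 + t^q)^(-1/p) dt`, whose inverse is the generalized hyperbolic sine. -/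
noncomputable def genG (p q y : ℝ) : ℝ := ∫ t in (0:ℝ)..y, (1 + t ^ q) ^ (-(1 / p))

/-- The generalized π, `π_{p,q} = 2∫_0^1 (1 - t^q)^(-1/p) dt`, as an extended real number
(it is `∞` when `q/(q+1) < p ≤ 1`). -/
noncomputable def genPi (p q : ℝ) : ℝ≥0∞ :=
  2 * ∫⁻ t in Ioo (0:ℝ) 1, ENNReal.ofReal ((1 - t ^ q) ^ (-(1 / p)))

/-- The generalized sine `sin_{p,q}`: the inverse of `genF p q`, which maps `[0,1)` onto
`[0, π_{p,q}/2)`. -/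
noncomputable def gsin (p q : ℝ) : ℝ → ℝ := Function.invFunOn (genF p q) (Ico 0 1)

/-- The generalized cosine `cos_{p,q} x = (d/dx) sin_{p,q} x` (one-sided at `x = 0`). -/
noncomputable def gcos (p q x : ℝ) : ℝ := derivWithin (gsin p q) (Ici 0) x

/-- The generalized hyperbolic sine `sinh_{p,q}`: the inverse of `genG p q`, which maps
`[0,∞)` onto `[0, π_{r,q}/2)` where `r = pq/(pq+p-q)`. -/
noncomputable def gsinh (p q : ℝ) : ℝ → ℝ := Function.invFunOn (genG p q) (Ici 0)

/-- The generalized hyperbolic cosine `cosh_{p,q} x = (d/dx) sinh_{p,q} x`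
(one-sided at `x = 0`). -/
noncomputable def gcosh (p q x : ℝ) : ℝ := derivWithin (gsinh p q) (Ici 0) x

/-- The generalized π, `π_{p,q} = 2∫_0^1 (1 - t^q)^(-1/p) dt`, as a real number
(valid for `p > 1`, where the integral converges). -/
noncomputable def genPiR (p q : ℝ) : ℝ := 2 * ∫ t in (0:ℝ)..1, (1 - t ^ q) ^ (-(1 / p))

/-- The integrand of `genF 3 6`. -/
noncomputable def integrandThreeSix (t : ℝ) : ℝ := (1 - t ^ 6) ^ (-(1 / 3 : ℝ))

theorem genF_three_six_eq (y : ℝ) :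
    genF 3 6 y = ∫ t in (0:ℝ)..y, integrandThreeSix t := by
  simp only [genF, integrandThreeSix, Real.rpow_ofNat]

theorem one_sub_pow_six_pos {t : ℝ} (ht : t ∈ Ioo (-1 : ℝ) 1) : 0 < 1 - t ^ 6 := by
  have h2 : t ^ 2 < 1 := by nlinarith [ht.1, ht.2]
  have h : (t ^ 2) ^ 3 < 1 := pow_lt_one₀ (sq_nonneg t) h2 (by norm_num)
  have h6 : (t ^ 2) ^ 3 = t ^ 6 := by ring
  linarith

theorem integrandThreeSix_pos {t : ℝ} (ht : t ∈ Ioo (-1 : ℝ) 1) : 0 < integrandThreeSix t :=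
  Real.rpow_pos_of_pos (one_sub_pow_six_pos ht) _

theorem integrandThreeSix_cube {t : ℝ} (ht : t ∈ Ioo (-1 : ℝ) 1) :
    integrandThreeSix t ^ 3 = (1 - t ^ 6)⁻¹ := by
  rw [integrandThreeSix, ← Real.rpow_natCast, ← Real.rpow_mul (one_sub_pow_six_pos ht).le]
  norm_num [Real.rpow_neg_one]

theorem continuousOn_integrandThreeSix : ContinuousOn integrandThreeSix (Ioo (-1 : ℝ) 1) := by
  unfold integrandThreeSix
  exact ContinuousOn.rpow_const (by fun_prop) fun t ht => Or.inl (one_sub_pow_six_pos ht).ne'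

theorem hasDerivAt_genF_three_six {y : ℝ} (hy : y ∈ Ioo (-1 : ℝ) 1) :
    HasDerivAt (genF 3 6) (integrandThreeSix y) y := by
  have hsub : uIcc 0 y ⊆ Ioo (-1 : ℝ) 1 :=
    (convex_Ioo (-1 : ℝ) 1).ordConnected.uIcc_subset (by norm_num) hy
  rw [funext genF_three_six_eq]
  exact intervalIntegral.integral_hasDerivAt_right
    (continuousOn_integrandThreeSix.mono hsub).intervalIntegrable
    (continuousOn_integrandThreeSix.stronglyMeasurableAtFilter isOpen_Ioo y hy)
    (continuousOn_integrandThreeSix.continuousAt (isOpen_Ioo.mem_nhds hy))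

theorem strictMonoOn_genF_three_six : StrictMonoOn (genF 3 6) (Ico 0 1) := by
  have hmem : ∀ y ∈ Ico (0 : ℝ) 1, y ∈ Ioo (-1 : ℝ) 1 := fun y hy => ⟨by linarith [hy.1], hy.2⟩
  refine strictMonoOn_of_deriv_pos (convex_Ico 0 1)
    (fun y hy => (hasDerivAt_genF_three_six (hmem y hy)).continuousAt.continuousWithinAt) ?_
  intro y hy
  have hy' := hmem y (interior_subset hy)
  rw [(hasDerivAt_genF_three_six hy').deriv]
  exact integrandThreeSix_pos hy'

theorem gsin_three_six_genF {y : ℝ} (hy : y ∈ Ico (0 : ℝ) 1) : gsin 3 6 (genF 3 6 y) = y :=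
  strictMonoOn_genF_three_six.injOn.leftInvOn_invFunOn hy

theorem continuousOn_genF_three_six (h : genPiR 3 6 ≠ 0) :
    ContinuousOn (genF 3 6) (Icc 0 1) := by
  have hint : IntervalIntegrable integrandThreeSix volume 0 1 := by
    by_contra hni
    refine h ?_
    have h0 := intervalIntegral.integral_undef hni
    rw [← genF_three_six_eq] at h0
    exact (congrArg (2 * ·) h0).trans (mul_zero 2)
  rw [funext genF_three_six_eq, ← uIcc_of_le zero_le_one]
  refine intervalIntegral.continuousOn_primitive_interval ?_
  rw [uIcc_of_le zero_le_one, integrableOn_Icc_iff_integrableOn_Ioc]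
  exact (intervalIntegrable_iff_integrableOn_Ioc_of_le zero_le_one).1 hint

/-- The base of the power in the denominator of the duplication formula, with `u = s ^ 3`. -/
noncomputable def doubleDen (u : ℝ) : ℝ :=
  (1 - u) * (1 + 6 * u + u ^ 2) ^ ((3:ℝ) / 2) + (1 + u) * (1 - 6 * u + u ^ 2) ^ ((3:ℝ) / 2)

/-- The duplication map of `sin_{3,6}`. -/
noncomputable def doubleMap (s : ℝ) : ℝ :=
  2 ^ ((5:ℝ) / 3) * s * (1 + s ^ 6) / doubleDen (s ^ 3) ^ ((2:ℝ) / 3)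

theorem rpow_three_halves {a : ℝ} (ha : 0 ≤ a) : a ^ ((3:ℝ) / 2) = √a ^ 3 := by
  rw [Real.sqrt_eq_rpow, ← Real.rpow_natCast, ← Real.rpow_mul ha]
  norm_num

theorem doubleDen_eq {u : ℝ} (hu : 0 ≤ u) (hB : 0 ≤ 1 - 6 * u + u ^ 2) :
    doubleDen u = (1 - u) * √(1 + 6 * u + u ^ 2) ^ 3 + (1 + u) * √(1 - 6 * u + u ^ 2) ^ 3 := by
  rw [doubleDen, rpow_three_halves (by positivity), rpow_three_halves hB]

theorem doubleDen_pos {u : ℝ} (hu : 0 ≤ u) (hu1 : u < 1) (hB : 0 ≤ 1 - 6 * u + u ^ 2) :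
    0 < doubleDen u := by
  have h1 : 0 < 1 - u := by linarith
  rw [doubleDen_eq hu hB]
  positivity

theorem hasDerivAt_doubleDen {u : ℝ} (hu : 0 ≤ u) (hB : 0 ≤ 1 - 6 * u + u ^ 2) :
    HasDerivAt doubleDen (4 * (√(1 + 6 * u + u ^ 2) * (2 - 3 * u - u ^ 2)
      - √(1 - 6 * u + u ^ 2) * (2 + 3 * u - u ^ 2))) u := by
  have hA : 0 ≤ 1 + 6 * u + u ^ 2 := by positivity
  have hid := hasDerivAt_id' u
  have h1 : (1:ℝ) ≤ 3 / 2 := by norm_num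
  have dA : HasDerivAt (fun u : ℝ => 1 + 6 * u + u ^ 2) (6 + 2 * u) u := by
    simpa using ((hid.const_mul 6).const_add 1).fun_add (hid.fun_pow 2)
  have dB : HasDerivAt (fun u : ℝ => 1 - 6 * u + u ^ 2) (-6 + 2 * u) u := by
    simpa using ((hid.const_mul 6).const_sub 1).fun_add (hid.fun_pow 2)
  have d := ((hid.const_sub 1).mul (dA.rpow_const (p := 3 / 2) (Or.inr h1))).add
    ((hid.const_add 1).mul (dB.rpow_const (p := 3 / 2) (Or.inr h1)))
  refine d.congr_deriv ?_
  rw [rpow_three_halves hA, rpow_three_halves hB, show (3:ℝ) / 2 - 1 = 1 / 2 by norm_num,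
    ← Real.sqrt_eq_rpow, ← Real.sqrt_eq_rpow]
  have sA := Real.sq_sqrt hA
  have sB := Real.sq_sqrt hB
  linear_combination (-√(1 + 6 * u + u ^ 2)) * sA + √(1 - 6 * u + u ^ 2) * sB

/-- The differential equation behind the duplication formula. -/
theorem doubleDen_ode {u : ℝ} (hu : 0 ≤ u) (hB : 0 ≤ 1 - 6 * u + u ^ 2) :
    (1 + 7 * u ^ 2) * doubleDen u - 2 * u * (1 + u ^ 2) *
      (4 * (√(1 + 6 * u + u ^ 2) * (2 - 3 * u - u ^ 2)
        - √(1 - 6 * u + u ^ 2) * (2 + 3 * u - u ^ 2))) =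
      √(1 + 6 * u + u ^ 2) * √(1 - 6 * u + u ^ 2) * doubleDen u := by
  have hA : 0 ≤ 1 + 6 * u + u ^ 2 := by positivity
  rw [doubleDen_eq hu hB]
  have sA := Real.sq_sqrt hA
  have sB := Real.sq_sqrt hB
  set A := √(1 + 6 * u + u ^ 2)
  set B := √(1 - 6 * u + u ^ 2)
  linear_combination ((1 + 7 * u ^ 2) * (1 - u) * A
      - (1 - u) * B * (A ^ 2 + (1 + 6 * u + u ^ 2))) * sA
    + ((1 + 7 * u ^ 2) * (1 + u) * B - (1 + u) * A * (B ^ 2 + (1 - 6 * u + u ^ 2))) * sB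

theorem two_rpow_five_thirds_cube : ((2:ℝ) ^ ((5:ℝ) / 3)) ^ 3 = 32 := by
  rw [← Real.rpow_natCast, ← Real.rpow_mul zero_le_two]
  norm_num [show (5:ℝ) = (5:ℕ) by norm_num, -Nat.cast_ofNat]

theorem doubleMap_cube {s : ℝ} (hs : 0 ≤ s) (hs1 : s ^ 3 < 1)
    (hB : 0 ≤ 1 - 6 * s ^ 3 + (s ^ 3) ^ 2) :
    doubleMap s ^ 3 =
      ((1 - s ^ 3) * √(1 + 6 * s ^ 3 + (s ^ 3) ^ 2) ^ 3
        - (1 + s ^ 3) * √(1 - 6 * s ^ 3 + (s ^ 3) ^ 2) ^ 3) / doubleDen (s ^ 3) := by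
  have hD := doubleDen_pos (by positivity) hs1 hB
  have h23 : (doubleDen (s ^ 3) ^ ((2:ℝ) / 3)) ^ 3 = doubleDen (s ^ 3) ^ 2 := by
    rw [← Real.rpow_natCast, ← Real.rpow_mul hD.le]
    norm_num
  rw [doubleMap, div_pow, mul_pow, mul_pow, two_rpow_five_thirds_cube, h23,
    div_eq_div_iff (pow_pos hD 2).ne' hD.ne']
  have hDe := doubleDen_eq (by positivity) hB
  have hA : 0 ≤ 1 + 6 * s ^ 3 + (s ^ 3) ^ 2 := by positivity
  have sA := Real.sq_sqrt hA
  have sB := Real.sq_sqrt hB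
  set A := √(1 + 6 * s ^ 3 + (s ^ 3) ^ 2)
  set B := √(1 - 6 * s ^ 3 + (s ^ 3) ^ 2)
  have key : ((1 - s ^ 3) * A ^ 3 - (1 + s ^ 3) * B ^ 3) * ((1 - s ^ 3) * A ^ 3
      + (1 + s ^ 3) * B ^ 3) = 32 * s ^ 3 * (1 + s ^ 6) ^ 3 := by
    have : ((1 - s ^ 3) * A ^ 3 - (1 + s ^ 3) * B ^ 3) * ((1 - s ^ 3) * A ^ 3
      + (1 + s ^ 3) * B ^ 3) = (1 - s ^ 3) ^ 2 * (A ^ 2) ^ 3 - (1 + s ^ 3) ^ 2 * (B ^ 2) ^ 3 := by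
      ring
    rw [this, sA, sB]
    ring
  rw [← hDe] at key
  rw [← key]
  ring

theorem one_sub_doubleMap_pow_six {s : ℝ} (hs : 0 ≤ s) (hs1 : s ^ 3 < 1)
    (hB : 0 ≤ 1 - 6 * s ^ 3 + (s ^ 3) ^ 2) :
    1 - doubleMap s ^ 6 = 4 * (1 - s ^ 6) *
      (√(1 + 6 * s ^ 3 + (s ^ 3) ^ 2) * √(1 - 6 * s ^ 3 + (s ^ 3) ^ 2)) ^ 3
        / doubleDen (s ^ 3) ^ 2 := by
  have hD := doubleDen_pos (by positivity) hs1 hB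
  rw [show doubleMap s ^ 6 = (doubleMap s ^ 3) ^ 2 by ring, doubleMap_cube hs hs1 hB,
    eq_div_iff (pow_pos hD 2).ne', div_pow, sub_mul, div_mul_cancel₀ _ (pow_pos hD 2).ne',
    doubleDen_eq (by positivity) hB]
  ring

theorem doubleMap_nonneg {s : ℝ} (hs : 0 ≤ s) (hs1 : s ^ 3 < 1)
    (hB : 0 ≤ 1 - 6 * s ^ 3 + (s ^ 3) ^ 2) : 0 ≤ doubleMap s := by
  have hD := doubleDen_pos (by positivity) hs1 hB
  unfold doubleMap
  positivity

theorem doubleMap_lt_one {s : ℝ} (hs : 0 ≤ s) (hs1 : s ^ 3 < 1)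
    (hB : 0 < 1 - 6 * s ^ 3 + (s ^ 3) ^ 2) : doubleMap s < 1 := by
  have hD := doubleDen_pos (by positivity) hs1 hB.le
  have h6 : 0 < 1 - s ^ 6 := by nlinarith [pow_nonneg hs 3]
  have h : 0 < 1 - doubleMap s ^ 6 := by
    rw [one_sub_doubleMap_pow_six hs hs1 hB.le]
    positivity
  exact lt_of_pow_lt_pow_left₀ 6 zero_le_one (by linarith)

theorem doubleMap_eq_one {s : ℝ} (hs : 0 ≤ s) (hs1 : s ^ 3 < 1)
    (hB : 1 - 6 * s ^ 3 + (s ^ 3) ^ 2 = 0) : doubleMap s = 1 := by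
  have h := one_sub_doubleMap_pow_six hs hs1 hB.ge
  rw [hB] at h
  norm_num at h
  exact (pow_eq_one_iff_of_nonneg (doubleMap_nonneg hs hs1 hB.ge) (n := 6) (by norm_num)).1
    (by linarith)

theorem hasDerivAt_doubleMap {s : ℝ} (hs : 0 ≤ s) (hs1 : s ^ 3 < 1)
    (hB : 0 ≤ 1 - 6 * s ^ 3 + (s ^ 3) ^ 2) :
    HasDerivAt doubleMap (2 ^ ((5:ℝ) / 3) * doubleDen (s ^ 3) ^ (-(2 / 3 : ℝ)) *
      (√(1 + 6 * s ^ 3 + (s ^ 3) ^ 2) * √(1 - 6 * s ^ 3 + (s ^ 3) ^ 2))) s := by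
  have hu : 0 ≤ s ^ 3 := by positivity
  have hD := doubleDen_pos hu hs1 hB
  have dD := HasDerivAt.comp (h := fun s : ℝ => s ^ 3) s (hasDerivAt_doubleDen hu hB) (hasDerivAt_pow 3 s)
  have dN : HasDerivAt (fun s : ℝ => 2 ^ ((5:ℝ) / 3) * (s + s ^ 7))
      (2 ^ ((5:ℝ) / 3) * (1 + 7 * s ^ 6)) s := by
    simpa using ((hasDerivAt_id' s).add (hasDerivAt_pow 7 s)).const_mul ((2:ℝ) ^ ((5:ℝ) / 3))
  have dP := dD.rpow_const (p := 2 / 3) (Or.inl hD.ne')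
  have d := dN.div dP (Real.rpow_pos_of_pos hD _).ne'
  have hfun : doubleMap = fun s : ℝ =>
      2 ^ ((5:ℝ) / 3) * (s + s ^ 7) / (doubleDen ∘ fun s => s ^ 3) s ^ ((2:ℝ) / 3) := by
    funext s
    simp only [doubleMap, Function.comp]
    ring
  rw [hfun]
  refine d.congr_deriv ?_
  have ode := doubleDen_ode hu hB
  simp only [Function.comp]
  rw [Real.rpow_sub_one hD.ne', Real.rpow_neg hD.le]
  have hE := (Real.rpow_pos_of_pos hD (2 / 3)).ne'
  have hD' := hD.ne'
  clear d dP dD dN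
  generalize doubleDen (s ^ 3) ^ (2 / 3 : ℝ) = E at *
  generalize √(1 + 6 * s ^ 3 + (s ^ 3) ^ 2) = A at *
  generalize √(1 - 6 * s ^ 3 + (s ^ 3) ^ 2) = B at *
  field_simp
  push_cast
  linear_combination 3 * ode

theorem integrandThreeSix_doubleMap_mul {s : ℝ} (hs : 0 ≤ s) (hs1 : s ^ 3 < 1)
    (hB : 0 < 1 - 6 * s ^ 3 + (s ^ 3) ^ 2) :
    integrandThreeSix (doubleMap s) * (2 ^ ((5:ℝ) / 3) * doubleDen (s ^ 3) ^ (-(2 / 3 : ℝ)) *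
      (√(1 + 6 * s ^ 3 + (s ^ 3) ^ 2) * √(1 - 6 * s ^ 3 + (s ^ 3) ^ 2))) =
      2 * integrandThreeSix s := by
  have hD := doubleDen_pos (by positivity) hs1 hB.le
  have h6 : 0 < 1 - s ^ 6 := by nlinarith [pow_nonneg hs 3]
  have hsI : s ∈ Ioo (-1 : ℝ) 1 :=
    ⟨by linarith, lt_of_pow_lt_pow_left₀ 3 zero_le_one (by linarith)⟩
  have hTI : doubleMap s ∈ Ioo (-1 : ℝ) 1 :=
    ⟨by linarith [doubleMap_nonneg hs hs1 hB.le], doubleMap_lt_one hs hs1 hB⟩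
  have h23 : (doubleDen (s ^ 3) ^ (-(2 / 3 : ℝ))) ^ 3 = (doubleDen (s ^ 3) ^ 2)⁻¹ := by
    rw [← Real.rpow_natCast, ← Real.rpow_mul hD.le, ← Real.rpow_natCast (doubleDen (s ^ 3)) 2,
      ← Real.rpow_neg hD.le]
    norm_num
  refine (Odd.strictMono_pow (n := 3) (by decide)).injective ?_
  simp only [mul_pow _ _ 3]
  rw [integrandThreeSix_cube hsI, integrandThreeSix_cube hTI, h23, two_rpow_five_thirds_cube,
    one_sub_doubleMap_pow_six hs hs1 hB.le]
  have hA : 0 < √(1 + 6 * s ^ 3 + (s ^ 3) ^ 2) := Real.sqrt_pos.2 (by positivity)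
  have hB' : 0 < √(1 - 6 * s ^ 3 + (s ^ 3) ^ 2) := Real.sqrt_pos.2 hB
  generalize √(1 + 6 * s ^ 3 + (s ^ 3) ^ 2) = A at *
  generalize √(1 - 6 * s ^ 3 + (s ^ 3) ^ 2) = B at *
  field_simp
  norm_num

/-- `sin_{3,6}` takes the value `a` at `π_{3,6} / 4`. -/
theorem exists_quarter_point : ∃ a : ℝ, 0 < a ∧ 1 - 6 * a ^ 3 + (a ^ 3) ^ 2 = 0 ∧ a ^ 3 < 1 := by
  have h2 := Real.sq_sqrt (zero_le_two (α := ℝ))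
  have hlt : √2 < 3 / 2 := by nlinarith [Real.sqrt_nonneg 2]
  have hgt : 1 < √2 := by nlinarith [Real.sqrt_nonneg 2]
  have hpos : 0 < 3 - 2 * √2 := by linarith
  refine ⟨(3 - 2 * √2) ^ (1 / 3 : ℝ), by positivity, ?_⟩
  have h3 : ((3 - 2 * √2) ^ (1 / 3 : ℝ)) ^ 3 = 3 - 2 * √2 := by
    rw [← Real.rpow_natCast, ← Real.rpow_mul hpos.le]
    norm_num
  rw [h3]
  exact ⟨by linear_combination 4 * h2, by linarith⟩

theorem genF_three_six_doubleMap (h : genPiR 3 6 ≠ 0) {a : ℝ}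
    (ha : 1 - 6 * a ^ 3 + (a ^ 3) ^ 2 = 0) (ha1 : a ^ 3 < 1) {s : ℝ} (hs : s ∈ Icc 0 a) :
    genF 3 6 (doubleMap s) = 2 * genF 3 6 s := by
  have hle : ∀ t ∈ Icc 0 a, t ^ 3 ≤ a ^ 3 := fun t ht => pow_le_pow_left₀ ht.1 ht.2 3
  have h1 : ∀ t ∈ Icc 0 a, t ^ 3 < 1 := fun t ht => (hle t ht).trans_lt ha1
  have hB : ∀ t ∈ Icc 0 a, 0 ≤ 1 - 6 * t ^ 3 + (t ^ 3) ^ 2 := fun t ht => by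
    nlinarith [hle t ht, h1 t ht]
  have hB' : ∀ t ∈ Ico 0 a, 0 < 1 - 6 * t ^ 3 + (t ^ 3) ^ 2 := fun t ht => by
    nlinarith [pow_lt_pow_left₀ ht.2 ht.1 (n := 3) (by norm_num)]
  have hlt : ∀ t ∈ Icc 0 a, t < 1 := fun t ht =>
    lt_of_pow_lt_pow_left₀ 3 zero_le_one (by linarith [h1 t ht])
  have hmaps : MapsTo doubleMap (Icc 0 a) (Icc 0 1) := fun t ht => by
    refine ⟨doubleMap_nonneg ht.1 (h1 t ht) (hB t ht), ?_⟩
    rcases (hB t ht).eq_or_lt with h0 | h0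
    · exact (doubleMap_eq_one ht.1 (h1 t ht) h0.symm).le
    · exact (doubleMap_lt_one ht.1 (h1 t ht) h0).le
  have hF := continuousOn_genF_three_six h
  have hcT : ContinuousOn doubleMap (Icc 0 a) := fun t ht =>
    (hasDerivAt_doubleMap ht.1 (h1 t ht) (hB t ht)).continuousAt.continuousWithinAt
  have hcont : ContinuousOn (fun t => genF 3 6 (doubleMap t) - 2 * genF 3 6 t) (Icc 0 a) :=
    (hF.comp hcT hmaps).sub
      ((hF.mono fun t ht => ⟨ht.1, (hlt t ht).le⟩).const_smul (2 : ℝ))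
  have hconst := constant_of_has_deriv_right_zero hcont (fun t ht => by
    have ht' := Ico_subset_Icc_self ht
    have hT : doubleMap t ∈ Ioo (-1 : ℝ) 1 :=
      ⟨by linarith [(hmaps ht').1], doubleMap_lt_one ht.1 (h1 t ht') (hB' t ht)⟩
    have d := ((hasDerivAt_genF_three_six hT).comp t
      (hasDerivAt_doubleMap ht.1 (h1 t ht') (hB t ht'))).sub
      ((hasDerivAt_genF_three_six ⟨by linarith [ht.1], hlt t ht'⟩).const_mul 2)
    rw [integrandThreeSix_doubleMap_mul ht.1 (h1 t ht') (hB' t ht), sub_self] at d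
    exact d.hasDerivWithinAt) s hs
  have h0 : genF 3 6 0 = 0 := by simp [genF]
  have hT0 : doubleMap 0 = 0 := by simp [doubleMap]
  simp only [hT0, h0] at hconst
  linarith

/-- double-angle formula for `sin_{3,6}` on `[0, π_{3,6}/4)`. -/
theorem double_angle_sin_three_six (x : ℝ) (hx0 : 0 ≤ x) (hx : x < genPiR 3 6 / 4)
    (s : ℝ) (hs : s = gsin 3 6 x) :
    gsin 3 6 (2 * x) =
      2 ^ ((5:ℝ) / 3) * s * (1 + s ^ 6) /
        ((1 - s ^ 3) * (1 + 6 * s ^ 3 + s ^ 6) ^ ((3:ℝ) / 2) +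
            (1 + s ^ 3) * (1 - 6 * s ^ 3 + s ^ 6) ^ ((3:ℝ) / 2)) ^ ((2:ℝ) / 3) := by
  have hpi : genPiR 3 6 ≠ 0 := by
    intro h
    rw [h] at hx
    linarith
  obtain ⟨a, ha0, ha, ha3⟩ := exists_quarter_point
  have ha1 : a < 1 := lt_of_pow_lt_pow_left₀ 3 zero_le_one (by linarith)
  have hF1 := genF_three_six_doubleMap hpi ha ha3 (right_mem_Icc.2 ha0.le)
  rw [doubleMap_eq_one ha0.le ha3 ha] at hF1
  have hxa : x < genF 3 6 a := by
    have : genPiR 3 6 = 2 * genF 3 6 1 := rfl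
    linarith
  have h0 : genF 3 6 0 = 0 := by simp [genF]
  obtain ⟨r, hr, rfl⟩ := intermediate_value_Icc ha0.le
    ((continuousOn_genF_three_six hpi).mono (Icc_subset_Icc_right ha1.le))
    (show x ∈ Icc (genF 3 6 0) (genF 3 6 a) from ⟨h0.trans_le hx0, hxa.le⟩)
  have hra : r < a := lt_of_le_of_ne hr.2 fun h => hxa.ne (congrArg _ h)
  have hr3 : r ^ 3 < a ^ 3 := pow_lt_pow_left₀ hra hr.1 (by norm_num)
  have hrB : 0 < 1 - 6 * r ^ 3 + (r ^ 3) ^ 2 := by nlinarith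
  rw [gsin_three_six_genF ⟨hr.1, hra.trans ha1⟩] at hs
  subst hs
  rw [← genF_three_six_doubleMap hpi ha ha3 hr, gsin_three_six_genF
    ⟨doubleMap_nonneg hr.1 (hr3.trans ha3) hrB.le, doubleMap_lt_one hr.1 (hr3.trans ha3) hrB⟩,
    doubleMap, doubleDen, ← pow_mul]
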